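/- CCS-normality is additive: if {X_α : α ∈ Λ} is a family of topological spaces each of which is CCS-normal, then the topological sum X = ⊕_{α∈Λ} X_α is CCS-normal. -/

import Mathlib

universe u v w

/-- A topological space is *cellular-compact* if for every family of pairwise disjoint
nonempty open subsets there exists a compact subset meeting every member of the family. -/
def CellularCompactSpace (X : Type w) [TopologicalSpace X] : Prop :=
  ∀ 𝒰 : Set (Set X), (∀ U ∈ 𝒰, IsOpen U) → (∀ U ∈ 𝒰, U.Nonempty) →
    𝒰.PairwiseDisjoint id →
    ∃ K : Set X, IsCompact K ∧ ∀ U ∈ 𝒰, (K ∩ U).Nonempty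
/-- A space `X` is *CCS-normal* if there are a normal space `Y` and a bijection `f : X → Y`
restricting to a homeomorphism `C → f '' C` on every cellular-compact subspace `C` of `X`. -/
def CCSNormal (X : Type w) [TopologicalSpace X] : Prop :=
  ∃ (Y : Type w) (tY : TopologicalSpace Y) (f : X → Y),
    NormalSpace Y ∧ Function.Bijective f ∧
      ∀ C : Set X, CellularCompactSpace C →
        IsHomeomorph (Set.MapsTo.restrict f C (f '' C) (Set.mapsTo_image f C))

open Topology

/-- A clopen subspace of a cellular-compact space is cellular-compact. -/
theorem CellularCompactSpace.of_isEmbedding_isClopen_range {X : Type v} {Y : Type w}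
    [TopologicalSpace X] [TopologicalSpace Y] (hY : CellularCompactSpace Y) {i : X → Y}
    (hi : IsEmbedding i) (hr : IsClopen (Set.range i)) : CellularCompactSpace X := by
  have ho : IsOpenEmbedding i := ⟨hi, hr.isOpen⟩
  have hc : IsClosedEmbedding i := ⟨hi, hr.isClosed⟩
  intro 𝒰 hopen hne hdisj
  obtain ⟨K, hK, hKU⟩ := hY (Set.image i '' 𝒰)
    (Set.forall_mem_image.2 fun U hU => ho.isOpenMap U (hopen U hU))
    (Set.forall_mem_image.2 fun U hU => (hne U hU).image i)
    (by
      rintro _ ⟨U, hU, rfl⟩ _ ⟨V, hV, rfl⟩ hUV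
      exact (Set.disjoint_image_iff hi.injective).2
        (hdisj hU hV fun h => hUV (congrArg (Set.image i) h)))
  refine ⟨i ⁻¹' K, hc.isCompact_preimage hK, fun U hU => ?_⟩
  obtain ⟨_, hxK, x, hxU, rfl⟩ := hKU _ (Set.mem_image_of_mem _ hU)
  exact ⟨x, hxK, hxU⟩

/-- A topological sum of normal spaces is normal. -/
theorem normalSpace_sigma {ι : Type u} {Y : ι → Type v} [∀ i, TopologicalSpace (Y i)]
    [∀ i, NormalSpace (Y i)] : NormalSpace (Σ i, Y i) where
  normal s t hs ht hst := by
    choose U V hU hV hsU htV hUV using fun i =>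
      normal_separation (isClosed_sigma_iff.1 hs i) (isClosed_sigma_iff.1 ht i)
        (hst.preimage (Sigma.mk i))
    refine ⟨{p | p.2 ∈ U p.1}, {p | p.2 ∈ V p.1}, isOpen_sigma_iff.2 hU, isOpen_sigma_iff.2 hV,
      fun p hp => hsU p.1 hp, fun p hp => htV p.1 hp, ?_⟩
    exact Set.disjoint_left.2 fun p hpU hpV => Set.disjoint_left.1 (hUV p.1) hpU hpV

/-- The restriction of a map to a set is a homeomorphism onto its image iff it is an
embedding. -/
theorem isHomeomorph_restrict_image_iff {X : Type v} {Y : Type w} [TopologicalSpace X]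
    [TopologicalSpace Y] {f : X → Y} {C : Set X} :
    IsHomeomorph (Set.MapsTo.restrict f C (f '' C) (Set.mapsTo_image f C)) ↔
      IsEmbedding (fun x : C => f x) := by
  rw [isHomeomorph_iff_isEmbedding_surjective]
  constructor
  · rintro ⟨h, -⟩
    exact IsEmbedding.subtypeVal.comp h
  · intro h
    refine ⟨h.codRestrict _ _, ?_⟩
    rintro ⟨_, x, hx, rfl⟩
    exact ⟨⟨x, hx⟩, rfl⟩

/-- A map of topological sums which preserves summands is an embedding on a subset `C` as soon as
it is so on the intersection of `C` with each summand. -/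
theorem isEmbedding_sigmaMap_id_restrict {ι : Type u} {X : ι → Type v} {Y : ι → Type w}
    [∀ i, TopologicalSpace (X i)] [∀ i, TopologicalSpace (Y i)] {f : ∀ i, X i → Y i}
    {C : Set (Σ i, X i)} (hf : ∀ i, IsEmbedding fun x : (Sigma.mk i ⁻¹' C : Set (X i)) => f i x) :
    IsEmbedding fun x : C => Sigma.map id f (x : Σ i, X i) := by
  let g : (Σ i, (Sigma.mk i ⁻¹' C : Set (X i))) → C := fun p => ⟨⟨p.1, p.2⟩, p.2.2⟩
  have hg : IsEmbedding g :=
    ((isEmbedding_sigmaMap (f₁ := id) (f₂ := fun i (x : (Sigma.mk i ⁻¹' C : Set (X i))) => x.1)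
      Function.injective_id).2 fun _ => IsEmbedding.subtypeVal).codRestrict C fun p => p.2.2
  have hgs : Function.Surjective g := fun x => ⟨⟨x.1.1, x.1.2, x.2⟩, rfl⟩
  let e := hg.toHomeomorphOfSurjective hgs
  have h := ((isEmbedding_sigmaMap (f₁ := id)
    (f₂ := fun i (x : (Sigma.mk i ⁻¹' C : Set (X i))) => f i x)
      Function.injective_id).2 hf).comp e.symm.isEmbedding
  convert h using 1
  funext x
  obtain ⟨p, rfl⟩ := e.surjective x
  simp only [Function.comp_apply, e.symm_apply_apply]
  rfl

/-- The intersection of a cellular-compact subspace of a topological sum with a summand is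
cellular-compact. -/
theorem CellularCompactSpace.preimage_sigmaMk {ι : Type u} {X : ι → Type v}
    [∀ i, TopologicalSpace (X i)] {C : Set (Σ i, X i)} (hC : CellularCompactSpace C) (i : ι) :
    CellularCompactSpace (Sigma.mk i ⁻¹' C : Set (X i)) := by
  refine hC.of_isEmbedding_isClopen_range
    (i := fun x => ⟨⟨i, x⟩, x.2⟩)
    ((IsEmbedding.sigmaMk.comp IsEmbedding.subtypeVal).codRestrict C fun x => x.2) ?_
  convert (isClopen_range_sigmaMk (X := X) (i := i)).preimage
    (continuous_subtype_val (p := (· ∈ C))) using 1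
  ext ⟨p, hp⟩
  constructor
  · rintro ⟨x, hx⟩
    exact ⟨x, congrArg Subtype.val hx⟩
  · rintro ⟨x, rfl⟩
    exact ⟨⟨x, hp⟩, rfl⟩

/-- **CCS-normality is additive**: the topological sum of a family of CCS-normal spaces is
CCS-normal. -/
theorem ccsNormal_sigma {Λ : Type u} {X : Λ → Type v} [∀ α, TopologicalSpace (X α)]
    (h : ∀ α, CCSNormal (X α)) : CCSNormal (Σ α, X α) := by
  choose Y tY f hY hbij hf using h
  refine ⟨Σ α, Y α, inferInstance, Sigma.map id f, normalSpace_sigma,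
    ⟨Function.injective_id.sigma_map fun α => (hbij α).1,
      Function.surjective_id.sigma_map fun α => (hbij α).2⟩, fun C hC => ?_⟩
  exact isHomeomorph_restrict_image_iff.2 <| isEmbedding_sigmaMap_id_restrict fun α =>
    isHomeomorph_restrict_image_iff.1 (hf α _ (hC.preimage_sigmaMk α))
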